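/- Let B be a real Banach space, V a nonempty weakly compact convex subset of B having normal structure, (Ω, 𝓕, P) a probability space, and T a strong random isometric operator from Ω × V to V. Then there exists a strong random element x⁰ : Ω → B with x⁰(ω) ∈ c(V,V) (the Chebyshev center of V) for all ω ∈ Ω such that T(ω, x⁰(ω)) = x⁰(ω) for almost all ω ∈ Ω. -/

import Mathlib

open MeasureTheory Set Filter Function
open scoped Classical

noncomputable section

namespace RNM


variable {B : Type*} [NormedAddCommGroup B] [NormedSpace ℝ B]

/-- `sup_{y ∈ K} ‖x − y‖`. -/
def supDist (K : Set B) (x : B) : ℝ := ⨆ y : K, ‖x - (y : B)‖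

/-- The Chebyshev radius `r(K,K)` of `K`. -/
def chebRadius (K : Set B) : ℝ := ⨅ z : K, supDist K (z : B)

/-- The Chebyshev center `c(K,K)` of `K`. -/
def chebCenter (K : Set B) : Set B := {x ∈ K | supDist K x = chebRadius K}

/-- `K` has normal structure: every closed convex subset of `K` containing more than one
point has a nondiametral point. -/
def NormalStructure (K : Set B) : Prop :=
  ∀ F, F ⊆ K → IsClosed F → Convex ℝ F → F.Nontrivial →
    ∃ x ∈ F, supDist F x < Metric.diam F

/-- `K` is compact in the weak topology of `B`. -/
def WeaklyCompact (K : Set B) : Prop := IsCompact (toWeakSpace ℝ B '' K)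



/-- Inner approximation of the projection of a Caratheodory zero set. -/
lemma sel_inner {Ω : Type*} [MeasurableSpace Ω] (μ : Measure Ω) [IsFiniteMeasure μ]
    (g : Ω → (ℕ → ℕ) → ℝ) (hg0 : ∀ ω α, 0 ≤ g ω α)
    (hgc : ∀ ω, Continuous (g ω)) (hgm : ∀ α, AEMeasurable (fun ω => g ω α) μ)
    (c : ENNReal) (hc : c < μ {ω | ∃ α, g ω α = 0}) :
    ∃ F, NullMeasurableSet F μ ∧ F ⊆ {ω | ∃ α, g ω α = 0} ∧ c ≤ μ F := by
  let A : Set (ℕ → ℕ) → Set Ω := fun U => {ω | ∃ α ∈ U, g ω α = 0}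
  have step : ∀ (k : ℕ) (U : {U : Set (ℕ → ℕ) // c < μ (A U)}),
      ∃ n : ℕ, c < μ (A (U.1 ∩ {α | α k ≤ n})) := by
    intro k U
    have hU : A U.1 = ⋃ n : ℕ, A (U.1 ∩ {α | α k ≤ n}) := by
      ext ω
      simp only [A, mem_ofPred_eq, mem_iUnion, mem_inter_iff]
      constructor
      · rintro ⟨α, h1, h2⟩
        exact ⟨α k, α, ⟨h1, le_rfl⟩, h2⟩
      · rintro ⟨n, α, ⟨h1, -⟩, h2⟩
        exact ⟨α, h1, h2⟩
    have hmono : Monotone (fun n : ℕ => A (U.1 ∩ {α | α k ≤ n})) := by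
      rintro n m hnm ω ⟨α, ⟨h1, h2⟩, h3⟩
      exact ⟨α, ⟨h1, le_trans h2 hnm⟩, h3⟩
    have h := U.2
    rw [hU, hmono.measure_iUnion] at h
    exact lt_iSup_iff.1 h
  choose n hn using step
  let W : ℕ → {U : Set (ℕ → ℕ) // c < μ (A U)} := fun k =>
    Nat.rec ⟨univ, by simpa [A] using hc⟩ (fun k U => ⟨U.1 ∩ {α | α k ≤ n k U}, hn k U⟩) k
  let β : ℕ → ℕ := fun k => n k (W k)
  have hW : ∀ k, (W k).1 = {α | ∀ i < k, α i ≤ β i} := by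
    intro k
    induction k with
    | zero => simp [W]
    | succ k ih =>
      have : (W (k+1)).1 = (W k).1 ∩ {α | α k ≤ β k} := rfl
      rw [this, ih]
      ext α
      simp only [mem_inter_iff, mem_ofPred_eq]
      constructor
      · rintro ⟨h1, h2⟩ i hi
        rcases Nat.lt_succ_iff_lt_or_eq.1 hi with h | rfl
        · exact h1 i h
        · exact h2
      · intro h
        exact ⟨fun i hi => h i (by omega), h k (by omega)⟩
  let F : ℕ → Set Ω := fun k => {ω | ∀ m : ℕ, ∃ α ∈ (W k).1, g ω α < 1 / ((m : ℝ) + 1)}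
  have hFm : ∀ k, NullMeasurableSet (F k) μ := by
    intro k
    obtain ⟨D, hD1, hD2, hD3⟩ :=
      (TopologicalSpace.IsSeparable.of_separableSpace (W k).1).exists_countable_dense_subset
    have : F k = ⋂ m : ℕ, ⋃ α ∈ D, {ω | g ω α < 1 / ((m : ℝ) + 1)} := by
      ext ω
      simp only [F, mem_ofPred_eq, mem_iInter, mem_iUnion, exists_prop]
      refine forall_congr' fun m => ?_
      constructor
      · rintro ⟨α, h1, h2⟩
        have ho : IsOpen {α | g ω α < 1 / ((m : ℝ) + 1)} := isOpen_lt (hgc ω) continuous_const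
        obtain ⟨x, hx1, hx2⟩ := mem_closure_iff.1 (hD3 h1) _ ho h2
        exact ⟨x, hx2, hx1⟩
      · rintro ⟨α, h1, h2⟩
        exact ⟨α, hD1 h1, h2⟩
    rw [this]
    refine NullMeasurableSet.iInter fun m => NullMeasurableSet.biUnion hD2 fun α _ => ?_
    exact (hgm α).nullMeasurableSet_preimage measurableSet_Iio
  have hFa : Antitone F := by
    intro k l hkl ω h m
    obtain ⟨α, h1, h2⟩ := h m
    refine ⟨α, ?_, h2⟩
    rw [hW] at h1 ⊢
    exact fun i hi => h1 i (by omega)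
  refine ⟨⋂ k, F k, NullMeasurableSet.iInter hFm, ?_, ?_⟩
  · intro ω hω
    have h : ∀ k : ℕ, ∃ α ∈ (W k).1, g ω α < 1 / ((k : ℝ) + 1) := fun k => mem_iInter.1 hω k k
    choose a ha1 ha2 using h
    have hcomp : IsCompact (Set.univ.pi fun i => Set.Iic (β i)) :=
      isCompact_univ_pi fun i => (Set.finite_Iic (β i)).isCompact
    obtain ⟨γ, -, φ, hφ, hlim⟩ := hcomp.tendsto_subseq (x := fun k i => min (a k i) (β i))
      (fun k i _ => mem_Iic.2 (min_le_right _ _))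
    have hlim2 : Tendsto (fun k => a (φ k)) atTop (nhds γ) := by
      rw [tendsto_pi_nhds] at hlim ⊢
      intro i
      refine (hlim i).congr' ?_
      filter_upwards [eventually_gt_atTop i] with k hk
      have h1 := ha1 (φ k)
      rw [hW] at h1
      have h2 := h1 i (lt_of_lt_of_le hk (hφ.id_le k))
      simp [h2]
    refine ⟨γ, ?_⟩
    have h3 := ((hgc ω).tendsto γ).comp hlim2
    have h4 : Tendsto (fun k => g ω (a (φ k))) atTop (nhds 0) := by
      have h5 : Tendsto (fun k : ℕ => 1 / (((φ k : ℕ) : ℝ) + 1)) atTop (nhds 0) :=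
        tendsto_one_div_add_atTop_nhds_zero_nat.comp hφ.tendsto_atTop
      exact squeeze_zero (fun k => hg0 _ _) (fun k => (ha2 (φ k)).le) h5
    exact tendsto_nhds_unique h3 h4
  · rw [hFa.measure_iInter hFm ⟨0, measure_ne_top _ _⟩]
    refine le_iInf fun k => (W k).2.le.trans (measure_mono ?_)
    rintro ω ⟨α, h1, h2⟩ m
    refine ⟨α, h1, ?_⟩
    rw [h2]
    positivity

lemma sel_null {Ω : Type*} [MeasurableSpace Ω] (μ : Measure Ω) [IsFiniteMeasure μ]
    (g : Ω → (ℕ → ℕ) → ℝ) (hg0 : ∀ ω α, 0 ≤ g ω α)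
    (hgc : ∀ ω, Continuous (g ω)) (hgm : ∀ α, AEMeasurable (fun ω => g ω α) μ) :
    NullMeasurableSet {ω | ∃ α, g ω α = 0} μ := by
  by_cases h0 : μ {ω | ∃ α, g ω α = 0} = 0
  · exact NullMeasurableSet.of_null h0
  obtain ⟨u, -, hu2, hu3⟩ := exists_seq_strictMono_tendsto' (pos_iff_ne_zero.2 h0)
  choose F hF1 hF2 hF3 using fun n => sel_inner μ g hg0 hgc hgm (u n) (hu2 n).2
  have hF : NullMeasurableSet (⋃ n, F n) μ := NullMeasurableSet.iUnion hF1
  have hle : μ {ω | ∃ α, g ω α = 0} ≤ μ (⋃ n, F n) :=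
    le_of_tendsto' hu3 fun n => (hF3 n).trans (measure_mono (subset_iUnion F n))
  exact hF.congr (ae_eq_of_subset_of_measure_ge (iUnion_subset hF2) hle hF (measure_ne_top _ _))

/-- Prepend a finite list to a sequence (overwriting the first entries). -/
def ins (s : List ℕ) (α : ℕ → ℕ) : ℕ → ℕ := fun i => if i < s.length then s.getD i 0 else α i

/-- Leftmost branch. -/
def lbr {Ω : Type*} (E : List ℕ → Set Ω) (ω : Ω) : ℕ → List ℕ
  | 0 => []
  | k + 1 => lbr E ω k ++ [sInf {n | ω ∈ E (lbr E ω k ++ [n])}]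

lemma sInf_meas {Ω : Type*} [MeasurableSpace Ω] (S : ℕ → Set Ω) (hS : ∀ n, MeasurableSet (S n)) :
    Measurable (fun ω => sInf {n | ω ∈ S n}) := by
  refine measurable_to_countable' fun n => ?_
  have : (fun ω => sInf {n | ω ∈ S n}) ⁻¹' {n} =
      (S n ∩ ⋂ m ∈ {m | m < n}, (S m)ᶜ) ∪ ({_ω | n = 0} ∩ ⋂ m, (S m)ᶜ) := by
    ext ω
    simp only [mem_preimage, mem_singleton_iff, mem_union, mem_inter_iff, mem_iInter,
      mem_compl_iff, mem_ofPred_eq]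
    constructor
    · rintro rfl
      by_cases h : {n | ω ∈ S n}.Nonempty
      · left
        exact ⟨Nat.sInf_mem h, fun m hm => Nat.notMem_of_lt_sInf hm⟩
      · right
        rw [not_nonempty_iff_eq_empty] at h
        refine ⟨by simp [h], fun m hm => ?_⟩
        have : m ∈ {n | ω ∈ S n} := hm
        simp [h] at this
    · rintro (⟨h1, h2⟩ | ⟨rfl, h2⟩)
      · apply le_antisymm (Nat.sInf_le h1)
        by_contra! hlt
        have h3 : sInf {n | ω ∈ S n} ∈ {n | ω ∈ S n} := Nat.sInf_mem ⟨n, h1⟩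
        exact h2 _ hlt h3
      · have : {n | ω ∈ S n} = ∅ := by
          ext m; simpa using h2 m
        simp [this]
  rw [this]
  refine MeasurableSet.union ((hS n).inter (MeasurableSet.biInter (to_countable _)
    fun m _ => (hS m).compl)) ((MeasurableSet.const _).inter (MeasurableSet.iInter
    fun m => (hS m).compl))

lemma lbr_meas {Ω : Type*} [MeasurableSpace Ω] (E : List ℕ → Set Ω)
    (hE : ∀ s, MeasurableSet (E s)) (k : ℕ) (s : List ℕ) : MeasurableSet {ω | lbr E ω k = s} := by
  induction k generalizing s with
  | zero => simp [lbr]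
  | succ k ih =>
    have : {ω | lbr E ω (k+1) = s} = ⋃ t : List ℕ, ({ω | lbr E ω k = t} ∩
        (fun ω => sInf {n | ω ∈ E (t ++ [n])}) ⁻¹' {n | t ++ [n] = s}) := by
      ext ω
      simp [lbr]
    rw [this]
    exact MeasurableSet.iUnion fun t => (ih t).inter
      (sInf_meas _ (fun n => hE _) (MeasurableSet.of_discrete))

lemma lbr_getD_meas {Ω : Type*} [MeasurableSpace Ω] (E : List ℕ → Set Ω)
    (hE : ∀ s, MeasurableSet (E s)) (k : ℕ) :
    Measurable (fun ω => (lbr E ω (k+1)).getD k 0) := by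
  refine measurable_to_countable' fun n => ?_
  have : (fun ω => (lbr E ω (k+1)).getD k 0) ⁻¹' {n} =
      ⋃ s ∈ {s : List ℕ | s.getD k 0 = n}, {ω | lbr E ω (k+1) = s} := by
    ext ω; simp
  rw [this]
  exact MeasurableSet.biUnion (to_countable _) fun s _ => lbr_meas E hE _ s

lemma lbr_length {Ω : Type*} (E : List ℕ → Set Ω) (ω : Ω) (k : ℕ) : (lbr E ω k).length = k := by
  induction k with
  | zero => rfl
  | succ k ih => simp [lbr, ih]

lemma lbr_getD {Ω : Type*} (E : List ℕ → Set Ω) (ω : Ω) (i k : ℕ) (h : i < k) :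
    (lbr E ω k).getD i 0 = (lbr E ω (i+1)).getD i 0 := by
  induction k, h using Nat.le_induction with
  | base => rfl
  | succ k hk ih =>
    rw [← ih]
    simp only [lbr]
    rw [List.getD_append]
    rw [lbr_length]; exact hk

/-- A measurable selection theorem. -/
lemma selection {Ω : Type*} [MeasurableSpace Ω] (μ : Measure Ω) [IsFiniteMeasure μ]
    (g : Ω → (ℕ → ℕ) → ℝ) (hg0 : ∀ ω α, 0 ≤ g ω α)
    (hgc : ∀ ω, Continuous (g ω)) (hgm : ∀ α, AEMeasurable (fun ω => g ω α) μ)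
    (hex : ∀ᵐ ω ∂μ, ∃ α, g ω α = 0) :
    ∃ a : Ω → (ℕ → ℕ), AEMeasurable a μ ∧ ∀ᵐ ω ∂μ, g ω (a ω) = 0 := by
  let E : List ℕ → Set Ω := fun s => {ω | ∃ α, g ω (ins s α) = 0}
  have hins : ∀ s, Continuous (ins s) := by
    intro s
    refine continuous_pi fun i => ?_
    unfold ins
    split_ifs
    · exact continuous_const
    · exact continuous_apply i
  have hE : ∀ s, NullMeasurableSet (E s) μ := fun s =>
    sel_null μ (fun ω α => g ω (ins s α)) (fun _ _ => hg0 _ _)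
      (fun ω => (hgc ω).comp (hins s)) (fun α => hgm _)
  let a : Ω → ℕ → ℕ := fun ω k => (lbr E ω (k+1)).getD k 0
  refine ⟨a, ?_, ?_⟩
  · rw [aemeasurable_pi_iff]
    intro k
    have h : NullMeasurable (fun ω => a ω k) μ :=
      @lbr_getD_meas (NullMeasurableSpace Ω μ) _ E hE k
    exact h.aemeasurable
  · filter_upwards [hex] with ω hω
    have hmem : ∀ k, ω ∈ E (lbr E ω k) := by
      intro k
      induction k with
      | zero =>
        obtain ⟨α, hα⟩ := hω
        have h0 : ins [] α = α := by ext i; simp [ins]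
        exact ⟨α, by rw [lbr, h0]; exact hα⟩
      | succ k ih =>
        obtain ⟨α, hα⟩ := ih
        have hne : {n | ω ∈ E (lbr E ω k ++ [n])}.Nonempty := by
          refine ⟨α k, α, ?_⟩
          rw [← hα]
          congr 1
          ext i
          simp only [ins, List.length_append, lbr_length, List.length_singleton]
          rcases lt_trichotomy i k with h | rfl | h
          · rw [if_pos (by omega), if_pos h, List.getD_append]
            rw [lbr_length]; exact h
          · rw [if_pos (by omega), if_neg (by omega), List.getD_append_right]
            · simp [lbr_length]
            · rw [lbr_length]
          · rw [if_neg (by omega), if_neg (by omega)]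
        exact Nat.sInf_mem hne
    choose b hb using hmem
    have hlim : Tendsto (fun k => ins (lbr E ω k) (b k)) atTop (nhds (a ω)) := by
      rw [tendsto_pi_nhds]
      intro i
      refine tendsto_const_nhds.congr' ?_
      filter_upwards [eventually_gt_atTop i] with k hk
      simp only [ins, lbr_length, if_pos hk, a]
      exact (lbr_getD E ω i k hk).symm
    have h3 := ((hgc ω).tendsto _).comp hlim
    have h4 : Tendsto (g ω ∘ fun k => ins (lbr E ω k) (b k)) atTop (nhds 0) := by
      simp only [Function.comp_def, hb]
      exact tendsto_const_nhds
    exact tendsto_nhds_unique h3 h4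

lemma wc_closed {V : Set B} (h : WeaklyCompact V) : IsClosed V := by
  have ht2 : T2Space (WeakSpace ℝ B) := (WeakBilin.isEmbedding (by
    intro x y hxy
    by_contra hne
    obtain ⟨f, hf⟩ := SeparatingDual.exists_separating_of_ne (R := ℝ) hne
    exact hf (by simpa using congrArg (fun l => l f) hxy))).t2Space
  have h1 : IsClosed (toWeakSpace ℝ B '' V) := h.isClosed
  have h2 := h1.preimage (toWeakSpaceCLM ℝ B).continuous
  have h3 : (toWeakSpaceCLM ℝ B) ⁻¹' (toWeakSpace ℝ B '' V) = V :=
    preimage_image_eq V (toWeakSpace ℝ B).injective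
  rwa [h3] at h2

lemma wc_bounded {V : Set B} (h : WeaklyCompact V) : ∃ C, ∀ x ∈ V, ‖x‖ ≤ C := by
  have : ∃ C', ∀ i : V, ‖NormedSpace.inclusionInDoubleDual ℝ B (i : B)‖ ≤ C' := by
    refine banach_steinhaus fun f => ?_
    have hc : Continuous (fun x : WeakSpace ℝ B => f ((toWeakSpace ℝ B).symm x)) :=
      WeakBilin.eval_continuous (topDualPairing ℝ B).flip f
    obtain ⟨C, hC⟩ := (h.image hc).isBounded.exists_norm_le
    refine ⟨C, fun i => ?_⟩
    rw [NormedSpace.dual_def]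
    refine hC _ ⟨toWeakSpace ℝ B i, mem_image_of_mem _ i.2, by simp⟩
  obtain ⟨C, hC⟩ := this
  refine ⟨C, fun x hx => ?_⟩
  have h1 := hC ⟨x, hx⟩
  have h2 := (NormedSpace.inclusionInDoubleDualLi (E := B) ℝ).norm_map x
  rw [← h2]
  exact h1

lemma wc_fip {V : Set B} (h : WeaklyCompact V) (c : Set (Set B)) (hne : c.Nonempty)
    (hch : IsChain (· ⊆ ·) c) (hc : ∀ s ∈ c, s ⊆ V ∧ IsClosed s ∧ Convex ℝ s ∧ s.Nonempty) :
    (⋂₀ c).Nonempty := by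
  have hcl : ∀ s ∈ c, IsClosed (toWeakSpace ℝ B '' s) := by
    intro s hs
    have h1 := (hc s hs).2.2.1.toWeakSpace_closure ℝ
    rw [(hc s hs).2.1.closure_eq] at h1
    rw [h1]
    exact isClosed_closure
  have : Nonempty c := hne.to_subtype
  have h2 := IsCompact.nonempty_iInter_of_directed_nonempty_isCompact_isClosed
    (fun s : c => toWeakSpace ℝ B '' s.1) (by
      intro s t
      rcases hch.total s.2 t.2 with h | h
      · exact ⟨s, subset_rfl, image_mono h⟩
      · exact ⟨t, image_mono h, subset_rfl⟩)
    (fun s => (hc s.1 s.2).2.2.2.image _)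
    (fun s => h.of_isClosed_subset (hcl s.1 s.2) (image_mono (hc s.1 s.2).1))
    (fun s => hcl s.1 s.2)
  obtain ⟨x, hx⟩ := h2
  refine ⟨(toWeakSpace ℝ B).symm x, ?_⟩
  intro s hs
  obtain ⟨y, hy, hyx⟩ := mem_iInter.1 hx ⟨s, hs⟩
  rw [← hyx]
  simpa using hy

lemma le_supDist {K : Set B} {C : ℝ} (hC : ∀ x ∈ K, ‖x‖ ≤ C) (x : B) {y : B} (hy : y ∈ K) :
    ‖x - y‖ ≤ supDist K x := by
  refine le_ciSup (f := fun y : K => ‖x - (y : B)‖) ⟨‖x‖ + C, ?_⟩ ⟨y, hy⟩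
  rintro _ ⟨z, rfl⟩
  exact (norm_sub_le _ _).trans (by have := hC z z.2; gcongr)

/-- The intersection of `K` with the balls of radius `r` centred at points of `S`. -/
def capB (K S : Set B) (r : ℝ) : Set B := {x ∈ K | ∀ y ∈ S, ‖x - y‖ ≤ r}

lemma capB_closed {K : Set B} (hK : IsClosed K) (S : Set B) (r : ℝ) : IsClosed (capB K S r) := by
  have : capB K S r = K ∩ ⋂ y ∈ S, {x | ‖x - y‖ ≤ r} := by
    ext x; simp [capB]
  rw [this]
  exact hK.inter (isClosed_biInter fun y _ => isClosed_le (by fun_prop) continuous_const)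

lemma capB_convex {K : Set B} (hK : Convex ℝ K) (S : Set B) (r : ℝ) : Convex ℝ (capB K S r) := by
  have : capB K S r = K ∩ ⋂ y ∈ S, Metric.closedBall y r := by
    ext x; simp [capB, dist_eq_norm]
  rw [this]
  exact hK.inter (convex_iInter₂ fun y _ => convex_closedBall y r)

lemma mem_cheb {V : Set B} (hne : V.Nonempty) {C : ℝ} (hC : ∀ x ∈ V, ‖x‖ ≤ C) (x : B) :
    x ∈ chebCenter V ↔ x ∈ capB V V (chebRadius V) := by
  have : Nonempty V := hne.to_subtype
  constructor
  · rintro ⟨h1, h2⟩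
    exact ⟨h1, fun y hy => h2 ▸ le_supDist hC x hy⟩
  · rintro ⟨h1, h2⟩
    refine ⟨h1, le_antisymm (ciSup_le fun y => h2 y y.2) ?_⟩
    refine ciInf_le (f := fun z : V => supDist V (z : B)) ⟨0, ?_⟩ ⟨x, h1⟩
    rintro _ ⟨z, rfl⟩
    exact Real.iSup_nonneg fun _ => norm_nonneg _

lemma cheb_nonempty {V : Set B} (hne : V.Nonempty) (hconv : Convex ℝ V) (hwc : WeaklyCompact V)
    [CompleteSpace B] : (capB V V (chebRadius V)).Nonempty := by
  obtain ⟨C, hC⟩ := wc_bounded hwc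
  have : Nonempty V := hne.to_subtype
  let s : ℕ → Set B := fun n => capB V V (chebRadius V + 1 / ((n : ℝ) + 1))
  have hanti : Antitone s := by
    intro n m hnm x hx
    refine ⟨hx.1, fun y hy => (hx.2 y hy).trans ?_⟩
    have := Nat.one_div_le_one_div (α := ℝ) hnm
    linarith
  obtain ⟨x, hx⟩ := wc_fip hwc (range s) (range_nonempty s) (by
      rintro _ ⟨n, rfl⟩ _ ⟨m, rfl⟩ -
      rcases le_total n m with h | h
      · right; exact hanti h
      · left; exact hanti h) (by
      rintro _ ⟨n, rfl⟩
      refine ⟨fun x hx => hx.1, capB_closed (wc_closed hwc) _ _, capB_convex hconv _ _, ?_⟩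
      have hlt : chebRadius V < chebRadius V + 1 / ((n : ℝ) + 1) := by
        have : (0:ℝ) < 1 / ((n : ℝ) + 1) := by positivity
        linarith
      obtain ⟨z, hz⟩ := exists_lt_of_ciInf_lt hlt
      exact ⟨z, z.2, fun y hy => (le_supDist hC _ hy).trans hz.le⟩)
  have hx' : ∀ n, x ∈ s n := fun n => hx _ ⟨n, rfl⟩
  refine ⟨x, (hx' 0).1, fun y hy => ?_⟩
  have hl : Tendsto (fun n : ℕ => chebRadius V + 1 / ((n : ℝ) + 1)) atTop
      (nhds (chebRadius V + 0)) :=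
    tendsto_const_nhds.add tendsto_one_div_add_atTop_nhds_zero_nat
  rw [add_zero] at hl
  exact ge_of_tendsto' hl fun n => (hx' n).2 y hy

/-- Kirk's fixed point theorem. -/
lemma kirk [CompleteSpace B] {V : Set B} (hwc : WeaklyCompact V) (hns : NormalStructure V)
    {F : Set B} (hFV : F ⊆ V) (hFc : IsClosed F) (hFconv : Convex ℝ F) (hFne : F.Nonempty)
    (T : B → B) (hT : MapsTo T F F) (hne : ∀ x ∈ F, ∀ y ∈ F, ‖T x - T y‖ ≤ ‖x - y‖) :
    ∃ p ∈ F, T p = p := by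
  obtain ⟨C, hC⟩ := wc_bounded hwc
  let S : Set (Set B) := {K | K ⊆ F ∧ IsClosed K ∧ Convex ℝ K ∧ K.Nonempty ∧ MapsTo T K K}
  obtain ⟨K, hKF, hK⟩ := zorn_superset_nonempty S (by
    intro c hcS hch hcne
    refine ⟨⋂₀ c, ⟨?_, ?_, ?_, ?_, ?_⟩, fun s hs => sInter_subset_of_mem hs⟩
    · obtain ⟨s, hs⟩ := hcne
      exact (sInter_subset_of_mem hs).trans (hcS hs).1
    · exact isClosed_sInter fun s hs => (hcS hs).2.1
    · exact convex_sInter fun s hs => (hcS hs).2.2.1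
    · exact wc_fip hwc c hcne hch fun s hs =>
        ⟨(hcS hs).1.trans hFV, (hcS hs).2.1, (hcS hs).2.2.1, (hcS hs).2.2.2.1⟩
    · intro x hx s hs
      exact (hcS hs).2.2.2.2 (hx s hs)) F ⟨subset_rfl, hFc, hFconv, hFne, hT⟩
  obtain ⟨-, hKc, hKconv, hKne, hKT⟩ := hK.prop
  have hmin : ∀ L ∈ S, L ⊆ K → K ⊆ L := fun L hL h => hK.le_of_le hL h
  -- the closed convex hull of the image is everything
  have hhull : K ⊆ closure (convexHull ℝ (T '' K)) := by
    have hsub : closure (convexHull ℝ (T '' K)) ⊆ K :=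
      closure_minimal (convexHull_min hKT.image_subset hKconv) hKc
    refine hmin _ ⟨hsub.trans hKF, isClosed_closure, (convex_convexHull ℝ _).closure, ?_, ?_⟩ hsub
    · exact ((hKne.image T).mono (subset_convexHull ℝ _)).mono subset_closure
    · intro x hx
      exact subset_closure (subset_convexHull ℝ _ (mem_image_of_mem T (hsub hx)))
  rcases K.subsingleton_or_nontrivial with hs | hnt
  · obtain ⟨p, hp⟩ := hKne
    exact ⟨p, hKF hp, hs (hKT hp) hp⟩
  · exfalso
    obtain ⟨x, hxK, hx⟩ := hns K (hKF.trans hFV) hKc hKconv hnt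
    have hCK : ∀ y ∈ K, ‖y‖ ≤ C := fun y hy => hC y (hFV (hKF hy))
    have hsub : K ⊆ capB K K (supDist K x) := by
      refine hmin _ ⟨fun z hz => hKF hz.1, capB_closed hKc _ _, capB_convex hKconv _ _, ?_, ?_⟩
        (fun z hz => hz.1)
      · exact ⟨x, hxK, fun y hy => le_supDist hCK x hy⟩
      · intro z hz
        refine ⟨hKT hz.1, fun y hy => ?_⟩
        have h1 : closure (convexHull ℝ (T '' K)) ⊆ Metric.closedBall (T z) (supDist K x) := by
          refine closure_minimal (convexHull_min ?_ (convex_closedBall _ _)) Metric.isClosed_closedBall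
          rintro _ ⟨w, hw, rfl⟩
          rw [Metric.mem_closedBall, dist_eq_norm, norm_sub_rev]
          exact (hne z (hKF hz.1) w (hKF hw)).trans (hz.2 w hw)
        have h2 := h1 (hhull hy)
        rwa [Metric.mem_closedBall, dist_eq_norm, norm_sub_rev] at h2
    have hd : Metric.diam K ≤ supDist K x := by
      refine Metric.diam_le_of_forall_dist_le ?_ fun y hy z hz => ?_
      · exact (norm_nonneg _).trans (le_supDist hCK x hxK)
      · rw [dist_eq_norm]
        exact (hsub hy).2 z hz
    linarith

/-- Deterministic fixed point inside an invariant subset meeting the Chebyshev center. -/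
lemma det_fixed [CompleteSpace B] {V : Set B} (hwc : WeaklyCompact V) (hns : NormalStructure V)
    (r : ℝ) {V0 : Set B} (hV0 : V0 ⊆ V) (hV0c : IsClosed V0) (hV0conv : Convex ℝ V0)
    {x : B} (hx0 : x ∈ V0) (hx : x ∈ capB V V r)
    (T : B → B) (hTV : MapsTo T V V) (hT : MapsTo T V0 V0)
    (hiso : ∀ x ∈ V, ∀ y ∈ V, ‖T x - T y‖ = ‖x - y‖) :
    ∃ p ∈ V0 ∩ capB V V r, T p = p := by
  have hit : ∀ n, MapsTo (T^[n]) V V := fun n => hTV.iterate n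
  let U : ℕ → Set B := fun n => capB V0 (T^[n] '' V) r
  have hUmono : Monotone U := by
    refine monotone_nat_of_le_succ fun n z hz => ⟨hz.1, ?_⟩
    rintro _ ⟨y, hy, rfl⟩
    exact hz.2 _ ⟨T y, hTV hy, by rw [Function.iterate_succ_apply]⟩
  have hUV : ∀ n, U n ⊆ V0 := fun n z hz => hz.1
  have hsub : closure (⋃ n, U n) ⊆ V0 := closure_minimal (iUnion_subset hUV) hV0c
  have hTc : ContinuousOn T V := by
    have : LipschitzOnWith 1 T V := LipschitzOnWith.of_dist_le_mul fun a ha b hb => by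
      simp [dist_eq_norm, hiso a ha b hb]
    exact this.continuousOn
  obtain ⟨p, hp, hTp⟩ := kirk hwc hns (F := closure (⋃ n, U n)) (hsub.trans hV0) isClosed_closure
    (Directed.convex_iUnion (hUmono.directed_le)
      (fun n => capB_convex hV0conv _ _)).closure
    ⟨x, subset_closure (mem_iUnion.2 ⟨0, hx0, by
      rintro _ ⟨y, hy, rfl⟩
      exact hx.2 y hy⟩)⟩ T (by
      intro z hz
      have h1 : MapsTo T (⋃ n, U n) (⋃ n, U n) := by
        intro z hz
        obtain ⟨n, hn⟩ := mem_iUnion.1 hz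
        refine mem_iUnion.2 ⟨n+1, hT hn.1, ?_⟩
        rintro _ ⟨y, hy, rfl⟩
        rw [Function.iterate_succ_apply', hiso _ (hV0 hn.1) _ (hit n hy)]
        exact hn.2 _ ⟨y, hy, rfl⟩
      exact h1.closure_of_continuousOn (hTc.mono (hsub.trans hV0)) hz)
    (fun a ha b hb => (hiso a (hV0 (hsub ha)) b (hV0 (hsub hb))).le)
  refine ⟨p, ⟨hsub hp, hV0 (hsub hp), fun y hy => ?_⟩, hTp⟩
  have hpi : ∀ n, ∀ y ∈ V, ‖p - T^[n] y‖ = ‖p - y‖ := by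
    intro n
    induction n with
    | zero => intro y _; rfl
    | succ n ih =>
      intro y hy
      rw [Function.iterate_succ_apply, ih _ (hTV hy)]
      conv_lhs => rw [← hTp]
      exact hiso p (hV0 (hsub hp)) y hy
  refine le_of_forall_pos_le_add fun ε hε => ?_
  obtain ⟨q, hq, hpq⟩ := Metric.mem_closure_iff.1 hp ε hε
  obtain ⟨n, hn⟩ := mem_iUnion.1 hq
  rw [← hpi n y hy]
  have h1 := hn.2 _ ⟨y, hy, rfl⟩
  rw [dist_eq_norm] at hpq
  calc ‖p - T^[n] y‖ = ‖(p - q) + (q - T^[n] y)‖ := by congr 1; abel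
    _ ≤ ‖p - q‖ + ‖q - T^[n] y‖ := norm_add_le _ _
    _ ≤ r + ε := by linarith

section

lemma sep_step {V : Set B} (hVc : IsClosed V) (hVconv : Convex ℝ V)
    {Ω : Type*} [MeasurableSpace Ω] (P : Measure Ω) (T : Ω → B → B)
    (hmaps : ∀ ω : Ω, Set.MapsTo (T ω) V V)
    (hmeas : ∀ x ∈ V, AEStronglyMeasurable (fun ω => T ω x) P)
    (hcont : ∀ ω, ContinuousOn (T ω) V) (S : Set B) (hS : TopologicalSpace.IsSeparable S) (hSV : S ⊆ V) :
    ∃ S', TopologicalSpace.IsSeparable S' ∧ S' ⊆ V ∧ S ⊆ S' ∧ Convex ℝ S' ∧ ∀ᵐ ω ∂P, MapsTo (T ω) S S' := by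
  obtain ⟨D, hDS, hDc, hSD⟩ := hS.exists_countable_dense_subset
  have h := fun d : D => (hmeas d (hSV (hDS d.2))).isSeparable_ae_range
  choose t ht1 ht2 using h
  have : Countable D := hDc.to_subtype
  let M : Submodule ℝ B := Submodule.span ℝ (S ∪ ⋃ d, t d)
  have hM : TopologicalSpace.IsSeparable (M : Set B) := (hS.union (TopologicalSpace.IsSeparable.iUnion ht1)).span
  refine ⟨V ∩ closure M, hM.closure.mono inter_subset_right, inter_subset_left,
    fun x hx => ⟨hSV hx, subset_closure (Submodule.subset_span (Or.inl hx))⟩,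
    hVconv.inter M.convex.closure, ?_⟩
  filter_upwards [ae_all_iff.2 ht2] with ω hω
  have h1 : MapsTo (T ω) D (closure M) := fun d hd =>
    subset_closure (Submodule.subset_span (Or.inr (mem_iUnion.2 ⟨⟨d, hd⟩, hω ⟨d, hd⟩⟩)))
  have hDV : closure D ⊆ V := closure_minimal (hDS.trans hSV) hVc
  have h2 := h1.closure_of_continuousOn ((hcont ω).mono hDV)
  rw [closure_closure] at h2
  exact fun x hx => ⟨hmaps ω (hSV hx), h2 (hSD hx)⟩

lemma sep_inv {V : Set B} (hVc : IsClosed V) (hVconv : Convex ℝ V)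
    {Ω : Type*} [MeasurableSpace Ω] (P : Measure Ω) (T : Ω → B → B)
    (hmaps : ∀ ω : Ω, Set.MapsTo (T ω) V V)
    (hmeas : ∀ x ∈ V, AEStronglyMeasurable (fun ω => T ω x) P)
    (hcont : ∀ ω, ContinuousOn (T ω) V) (x : B) (hx : x ∈ V) :
    ∃ S, TopologicalSpace.IsSeparable S ∧ S ⊆ V ∧ x ∈ S ∧ IsClosed S ∧ Convex ℝ S ∧
      ∀ᵐ ω ∂P, MapsTo (T ω) S S := by
  choose nx h1 h2 h3 h4 h5 using fun S : {S : Set B // TopologicalSpace.IsSeparable S ∧ S ⊆ V} =>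
    sep_step hVc hVconv P T hmaps hmeas hcont S.1 S.2.1 S.2.2
  let W : ℕ → {S : Set B // TopologicalSpace.IsSeparable S ∧ S ⊆ V} := fun k =>
    Nat.rec ⟨{x}, (Set.countable_singleton x).isSeparable, singleton_subset_iff.2 hx⟩
      (fun _ S => ⟨nx S, h1 S, h2 S⟩) k
  have hmono : Monotone (fun k => (W (k+1)).1) :=
    monotone_nat_of_le_succ fun k => h3 (W (k+1))
  have hW01 : (W 0).1 ⊆ (W 1).1 := h3 (W 0)
  have hsub : (⋃ k, (W (k+1)).1) ⊆ V := iUnion_subset fun k => (W (k+1)).2.2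
  refine ⟨closure (⋃ k, (W (k+1)).1), (TopologicalSpace.IsSeparable.iUnion fun k => (W (k+1)).2.1).closure,
    closure_minimal hsub hVc,
    subset_closure (mem_iUnion.2 ⟨0, hW01 (mem_singleton x)⟩), isClosed_closure,
    (Directed.convex_iUnion (hmono.directed_le) fun k => h4 (W k)).closure, ?_⟩
  filter_upwards [ae_all_iff.2 fun k => h5 (W k)] with ω hω
  have : MapsTo (T ω) (⋃ k, (W (k+1)).1) (⋃ k, (W (k+1)).1) := by
    intro z hz
    obtain ⟨k, hk⟩ := mem_iUnion.1 hz
    exact mem_iUnion.2 ⟨k+1, hω (k+1) hk⟩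
  exact this.closure_of_continuousOn ((hcont ω).mono (closure_minimal hsub hVc))

end

/-- A strong random isometric operator from `Ω × V` to `V`, where `V` is a nonempty
weakly compact convex subset with normal structure of a Banach space `B`, has a random
fixed point taking values in the Chebyshev center of `V`. -/
theorem random_fixed_point_of_isometric_in_chebCenter
    {B : Type*} [NormedAddCommGroup B] [NormedSpace ℝ B] [CompleteSpace B]
    (V : Set B) (hVne : V.Nonempty) (hVconv : Convex ℝ V)
    (hVwc : WeaklyCompact V) (hVns : NormalStructure V)
    {Ω : Type*} [MeasurableSpace Ω] (P : Measure Ω) [IsProbabilityMeasure P]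
    (T : Ω → B → B)
    (hmaps : ∀ ω : Ω, Set.MapsTo (T ω) V V)
    (hmeas : ∀ x ∈ V, AEStronglyMeasurable (fun ω => T ω x) P)
    (hiso : ∀ ω : Ω, ∀ x ∈ V, ∀ y ∈ V, ‖T ω x - T ω y‖ = ‖x - y‖) :
    ∃ x0 : Ω → B, AEStronglyMeasurable x0 P ∧ (∀ ω, x0 ω ∈ chebCenter V) ∧
      ∀ᵐ ω ∂P, T ω (x0 ω) = x0 ω := by
  obtain ⟨C, hC⟩ := wc_bounded hVwc
  have hVc := wc_closed hVwc
  have hcont : ∀ ω, ContinuousOn (T ω) V := by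
    intro ω
    have : LipschitzOnWith 1 (T ω) V := LipschitzOnWith.of_dist_le_mul fun a ha b hb => by
      simp [dist_eq_norm, hiso ω a ha b hb]
    exact this.continuousOn
  obtain ⟨x, hx⟩ := cheb_nonempty hVne hVconv hVwc
  obtain ⟨V0, hsep, hV0, hx0, hV0c, hV0conv, hV0T⟩ :=
    sep_inv hVc hVconv P T hmaps hmeas hcont x hx.1
  let D : Set B := V0 ∩ capB V V (chebRadius V)
  have hDc : IsClosed D := hV0c.inter (capB_closed hVc _ _)
  have hDsep : TopologicalSpace.SeparableSpace D := (hsep.mono inter_subset_left).separableSpace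
  have hDcomp : CompleteSpace D := hDc.completeSpace_coe
  have hDne : Nonempty D := ⟨⟨x, hx0, hx⟩⟩
  obtain ⟨Φ, hΦ, hΦs⟩ := exists_nat_nat_continuous_surjective_of_completeSpace D
  have hΦV : ∀ α, (Φ α : B) ∈ V := fun α => hV0 (Φ α).2.1
  have hΦc : Continuous fun α => (Φ α : B) := continuous_subtype_val.comp hΦ
  obtain ⟨a, ha, haz⟩ := selection P (fun ω α => ‖T ω (Φ α) - Φ α‖) (fun _ _ => norm_nonneg _)
    (fun ω => (((hcont ω).comp_continuous hΦc hΦV).sub hΦc).norm)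
    (fun α => ((hmeas _ (hΦV α)).sub aestronglyMeasurable_const).norm.aemeasurable)
    (by
      filter_upwards [hV0T] with ω hω
      obtain ⟨p, hp, hTp⟩ := det_fixed hVwc hVns _ hV0 hV0c hV0conv hx0 hx (T ω) (hmaps ω) hω
        (hiso ω)
      obtain ⟨α, hα⟩ := hΦs ⟨p, hp⟩
      exact ⟨α, by simp [hα, hTp]⟩)
  refine ⟨fun ω => Φ (a ω), hΦc.comp_aestronglyMeasurable ha.aestronglyMeasurable, ?_, ?_⟩
  · intro ω
    exact (mem_cheb hVne hC _).2 (Φ (a ω)).2.2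
  · filter_upwards [haz] with ω hω
    exact sub_eq_zero.1 (norm_eq_zero.1 hω)

end RNM
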